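/- arXiv:2106.12088 — 6 statements merged into one kernel-verified Lean document; each statement's English description precedes it below -/
import Mathlib

section
/- Suppose in addition that A is a left Noetherian domain. Then the algebraic subsets of R^n are the closed sets of a topology on R^n: the empty set and R^n are algebraic, the union of two algebraic sets is algebraic, and the intersection of any nonempty family of algebraic sets is algebraic. -/
/-- The two-sided ideal `⟨Z⟩` of `A` generated by `x 1 - z 1, …, x n - z n`. -/
def pointIdeal {A : Type*} [Ring A] {n : ℕ} (R : Subring A) (x : Fin n → A)
    (Z : Fin n → R) : TwoSidedIdeal A :=
  TwoSidedIdeal.span {a | ∃ i, a = x i - (Z i : A)}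

/-- The vanishing set `V(S)` of a set of polynomials `S ⊆ A`. -/
def vSet {A : Type*} [Ring A] {n : ℕ} (R : Subring A) (x : Fin n → A)
    (S : Set A) : Set (Fin n → R) :=
  {Z | ∀ f ∈ S, f ∈ pointIdeal R x Z}

/-- The ideal of points `I(X)` of a set of points `X ⊆ R^n`. -/
def iPts {A : Type*} [Ring A] {n : ℕ} (R : Subring A) (x : Fin n → A)
    (X : Set (Fin n → R)) : Set A :=
  {g | ∀ Z ∈ X, g ∈ pointIdeal R x Z}

/-- A subset `X ⊆ R^n` is algebraic if `X = R^n` or `X ⊆ V(g)` for some nonzero `g ∈ A`. -/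
def IsAlgebraicSet {A : Type*} [Ring A] {n : ℕ} (R : Subring A) (x : Fin n → A)
    (X : Set (Fin n → R)) : Prop :=
  X = Set.univ ∨ ∃ g : A, g ≠ 0 ∧ X ⊆ vSet R x {g}

namespace IsAlgebraicSet

variable {A : Type*} [Ring A] {n : ℕ} {R : Subring A} {x : Fin n → A}

theorem subset_vSet_singleton {X Y : Set (Fin n → R)} (hXY : X ⊆ Y)
    (hY : ∃ g : A, g ≠ 0 ∧ Y ⊆ vSet R x {g}) : IsAlgebraicSet R x X :=
  let ⟨g, hg, hYg⟩ := hY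
  Or.inr ⟨g, hg, hXY.trans hYg⟩

theorem empty [Nontrivial A] : IsAlgebraicSet R x (∅ : Set (Fin n → R)) :=
  Or.inr ⟨1, one_ne_zero, Set.empty_subset _⟩

theorem univ : IsAlgebraicSet R x (Set.univ : Set (Fin n → R)) :=
  Or.inl rfl

/-- Since the ideals `⟨Z⟩` are two-sided, `f * g` vanishes wherever `f` or `g` does. -/
theorem union [NoZeroDivisors A] {X Y : Set (Fin n → R)} (hX : IsAlgebraicSet R x X)
    (hY : IsAlgebraicSet R x Y) : IsAlgebraicSet R x (X ∪ Y) := by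
  rcases hX with rfl | ⟨f, hf, hXf⟩
  · exact Or.inl (Set.univ_union Y)
  rcases hY with rfl | ⟨g, hg, hYg⟩
  · exact Or.inl (Set.union_univ X)
  refine Or.inr ⟨f * g, mul_ne_zero hf hg, ?_⟩
  rintro Z (hZ | hZ) _ rfl
  · exact TwoSidedIdeal.mul_mem_right _ _ _ (hXf hZ f rfl)
  · exact TwoSidedIdeal.mul_mem_left _ _ _ (hYg hZ g rfl)

theorem sInter {S : Set (Set (Fin n → R))} (hS : ∀ X ∈ S, IsAlgebraicSet R x X) :
    IsAlgebraicSet R x (⋂₀ S) := by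
  by_cases h : ∀ X ∈ S, X = Set.univ
  · exact Or.inl (Set.sInter_eq_univ.mpr h)
  · push Not at h
    obtain ⟨X, hXS, hX⟩ := h
    exact subset_vSet_singleton (Set.sInter_subset_of_mem hXS) ((hS X hXS).resolve_left hX)

end IsAlgebraicSet

theorem stmt8 {A : Type*} [Ring A] [IsDomain A] [IsNoetherianRing A] {n : ℕ}
    (R : Subring A) (x : Fin n → A) :
    -- the algebraic sets are the closed sets of a topology on R^n
    (∃ t : TopologicalSpace (Fin n → R),
      ∀ X : Set (Fin n → R), @IsClosed _ t X ↔ IsAlgebraicSet R x X)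
    -- the empty set is algebraic
    ∧ IsAlgebraicSet R x (∅ : Set (Fin n → R))
    -- R^n is algebraic
    ∧ IsAlgebraicSet R x (Set.univ : Set (Fin n → R))
    -- the union of two algebraic sets is algebraic
    ∧ (∀ X Y : Set (Fin n → R),
        IsAlgebraicSet R x X → IsAlgebraicSet R x Y → IsAlgebraicSet R x (X ∪ Y))
    -- the intersection of any nonempty family of algebraic sets is algebraic
    ∧ (∀ (K : Type) [Nonempty K] (Xk : K → Set (Fin n → R)),
        (∀ k, IsAlgebraicSet R x (Xk k)) → IsAlgebraicSet R x (⋂ k, Xk k)) := by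
  refine ⟨⟨TopologicalSpace.ofClosed {X | IsAlgebraicSet R x X} .empty
    (fun _ h => .sInter h) (fun _ hX _ hY => hX.union hY), fun X => ?_⟩,
    .empty, .univ, fun _ _ => .union, fun K _ Xk h => ?_⟩
  · rw [← @isOpen_compl_iff]
    change IsAlgebraicSet R x Xᶜᶜ ↔ _
    rw [compl_compl]
  · exact .sInter (Set.forall_mem_range.mpr h)
end

section
/- If f = c x^α h, where c is an invertible element of R that is normal in R, x^α is a standard monomial, and h belongs to the center Z(A) of A, then f is a normal element of A. -/
/-- The standard monomial `x^α = x 1 ^ α 1 ⋯ x n ^ α n`. -/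
def smon {A : Type*} [Ring A] {n : ℕ} (x : Fin n → A) (α : Fin n → ℕ) : A :=
  (List.ofFn fun i => x i ^ α i).prod

/-- An element `f` of a ring is normal if `Af = fA`, expressed elementwise. -/
def IsNormalElement {A : Type*} [Ring A] (f : A) : Prop :=
  (∀ a, ∃ b, a * f = f * b) ∧ ∀ a, ∃ b, f * a = b * f

namespace IsNormalElement

variable {A : Type*} [Ring A]

theorem one : IsNormalElement (1 : A) :=
  ⟨fun a => ⟨a, by simp⟩, fun a => ⟨a, by simp⟩⟩

theorem mul {f g : A} (hf : IsNormalElement f) (hg : IsNormalElement g) :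
    IsNormalElement (f * g) := by
  refine ⟨fun a => ?_, fun a => ?_⟩
  · obtain ⟨b, hb⟩ := hf.1 a
    obtain ⟨d, hd⟩ := hg.1 b
    exact ⟨d, by rw [← mul_assoc, hb, mul_assoc, hd, mul_assoc]⟩
  · obtain ⟨b, hb⟩ := hg.2 a
    obtain ⟨d, hd⟩ := hf.2 b
    exact ⟨d, by rw [mul_assoc, hb, ← mul_assoc, hd, mul_assoc]⟩

theorem pow {f : A} (hf : IsNormalElement f) (k : ℕ) : IsNormalElement (f ^ k) := by
  induction k with
  | zero => simpa using one
  | succ k ih => simpa [pow_succ] using ih.mul hf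

theorem list_prod {l : List A} (hl : ∀ f ∈ l, IsNormalElement f) : IsNormalElement l.prod := by
  induction l with
  | nil => simpa using one
  | cons f l ih =>
    rw [List.prod_cons]
    exact (hl f (by simp)).mul (ih fun g hg => hl g (by simp [hg]))

theorem of_unit (u : Aˣ) : IsNormalElement (u : A) :=
  ⟨fun a => ⟨↑u⁻¹ * (a * u), by simp⟩, fun a => ⟨u * a * ↑u⁻¹, by simp⟩⟩

theorem of_mem_center {h : A} (hh : h ∈ Set.center A) : IsNormalElement h :=
  ⟨fun a => ⟨a, (hh.comm a).symm⟩, fun a => ⟨a, hh.comm a⟩⟩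

theorem smon {n : ℕ} {x : Fin n → A} (hx : ∀ i, IsNormalElement (x i)) (α : Fin n → ℕ) :
    IsNormalElement (smon x α) := by
  refine list_prod fun f hf => ?_
  obtain ⟨i, rfl⟩ := List.mem_ofFn.1 hf
  exact (hx i).pow _

theorem setOf_eq {f : A} (hf : IsNormalElement f) :
    {a * f | a : A} = {f * a | a : A} := by
  ext y
  constructor
  · rintro ⟨a, rfl⟩
    obtain ⟨b, hb⟩ := hf.1 a
    exact ⟨b, hb.symm⟩
  · rintro ⟨a, rfl⟩
    obtain ⟨b, hb⟩ := hf.2 a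
    exact ⟨b, hb.symm⟩

end IsNormalElement

/-- The elements `a` with `a * f ∈ f A` form a subring. -/
def subringMulMemLeft {A : Type*} [Ring A] (f : A) : Subring A where
  carrier := {a | ∃ b, a * f = f * b}
  one_mem' := ⟨1, by simp⟩
  zero_mem' := ⟨0, by simp⟩
  neg_mem' := by
    rintro a ⟨b, hb⟩
    exact ⟨-b, by simp [hb]⟩
  add_mem' := by
    rintro a a' ⟨b, hb⟩ ⟨b', hb'⟩
    exact ⟨b + b', by rw [add_mul, mul_add, hb, hb']⟩
  mul_mem' := by
    rintro a a' ⟨b, hb⟩ ⟨b', hb'⟩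
    exact ⟨b * b', by rw [mul_assoc, hb', ← mul_assoc, hb, mul_assoc]⟩

/-- The elements `a` with `f * a ∈ A f` form a subring. -/
def subringMulMemRight {A : Type*} [Ring A] (f : A) : Subring A where
  carrier := {a | ∃ b, f * a = b * f}
  one_mem' := ⟨1, by simp⟩
  zero_mem' := ⟨0, by simp⟩
  neg_mem' := by
    rintro a ⟨b, hb⟩
    exact ⟨-b, by simp [hb]⟩
  add_mem' := by
    rintro a a' ⟨b, hb⟩ ⟨b', hb'⟩
    exact ⟨b + b', by rw [mul_add, add_mul, hb, hb']⟩
  mul_mem' := by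
    rintro a a' ⟨b, hb⟩ ⟨b', hb'⟩
    exact ⟨b * b', by rw [← mul_assoc, hb, mul_assoc, hb', mul_assoc]⟩

theorem Subring.mem_of_smon_span {R A : Type*} [Ring R] [Ring A] {n : ℕ}
    {ι : R →+* A} {x : Fin n → A}
    (hspan : ∀ a : A, ∃ c : (Fin n → ℕ) →₀ R, a = c.sum fun α r => ι r * smon x α)
    (S : Subring A) (hι : ∀ r, ι r ∈ S) (hx : ∀ i, x i ∈ S) (a : A) : a ∈ S := by
  obtain ⟨c, rfl⟩ := hspan a
  refine S.sum_mem fun α _ => S.mul_mem (hι _) (S.list_prod_mem fun y hy => ?_)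
  obtain ⟨i, rfl⟩ := List.mem_ofFn.1 hy
  exact S.pow_mem (hx i) _

/-- Each variable of a quasi-commutative bijective skew PBW extension is normal. -/
theorem isNormalElement_variable {R A : Type*} [Ring R] [Ring A] {n : ℕ}
    {ι : R →+* A} {x : Fin n → A}
    (hspan : ∀ a : A, ∃ c : (Fin n → ℕ) →₀ R, a = c.sum fun α r => ι r * smon x α)
    {σ : Fin n → R ≃+* R} (hσ : ∀ (i : Fin n) (r : R), x i * ι r = ι (σ i r) * x i)
    {q : Fin n → Fin n → Rˣ}
    (hq : ∀ i j : Fin n, i < j → x j * x i = ι (q i j) * (x i * x j)) (i : Fin n) :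
    IsNormalElement (x i) := by
  have hcomm (i j : Fin n) : ∃ r : R, x j * x i = ι r * (x i * x j) := by
    rcases lt_trichotomy i j with hij | rfl | hij
    · exact ⟨_, hq i j hij⟩
    · exact ⟨1, by simp⟩
    · exact ⟨↑(q j i)⁻¹, by rw [hq j i hij, ← mul_assoc, ← map_mul]; simp⟩
  have hσ' (r : R) : ι r * x i = x i * ι ((σ i).symm r) := by simp [hσ]
  refine ⟨Subring.mem_of_smon_span hspan (subringMulMemLeft (x i)) (fun r => ⟨_, hσ' r⟩)
    fun j => ?_, Subring.mem_of_smon_span hspan (subringMulMemRight (x i))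
    (fun r => ⟨_, hσ i r⟩) fun j => ?_⟩
  · obtain ⟨r, hr⟩ := hcomm i j
    exact ⟨ι ((σ i).symm r) * x j, by rw [hr, ← mul_assoc, hσ', mul_assoc]⟩
  · obtain ⟨r, hr⟩ := hcomm j i
    exact ⟨ι r * x j, by rw [hr, mul_assoc]⟩

theorem stmt11 {R A : Type*} [Ring R] [Ring A] {n : ℕ}
    (ι : R →+* A) (hι : Function.Injective ι) (x : Fin n → A)
    -- (1) the standard monomials form a basis of A as a left R-module
    (hbasis : ∀ a : A, ∃! c : (Fin n → ℕ) →₀ R, a = c.sum fun α r => ι r * smon x α)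
    -- (2) ring automorphisms σ_i of R with x_i r = σ_i(r) x_i
    (σ : Fin n → R ≃+* R) (hσ : ∀ (i : Fin n) (r : R), x i * ι r = ι (σ i r) * x i)
    -- (3) invertible q_{ij} ∈ R with x_j x_i = q_{ij} x_i x_j for i < j
    (q : Fin n → Fin n → Rˣ)
    (hq : ∀ i j : Fin n, i < j → x j * x i = ι (q i j) * (x i * x j))
    -- f = c x^α h with c ∈ R invertible and normal in R, and h ∈ Z(A)
    (c : Rˣ) (hc : {r * (c : R) | r : R} = {(c : R) * r | r : R})
    (α : Fin n → ℕ) (h : A) (hh : h ∈ Set.center A)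
    (f : A) (hf : f = ι (c : R) * smon x α * h) :
    -- f is normal in A, i.e. Af = fA
    {a * f | a : A} = {f * a | a : A} := by
  subst hf
  have hx := isNormalElement_variable (fun a => (hbasis a).exists) hσ hq
  exact (((IsNormalElement.of_unit (Units.map (ι : R →* A) c)).mul
    (.smon hx α)).mul (.of_mem_center hh)).setOf_eq
end

section
/- Assume in addition that A is a domain. If f = c_1 x^{α_1} + ⋯ + c_t x^{α_t} is a nonzero normal element of A, where c_1, …, c_t ∈ R are nonzero and x^{α_1}, …, x^{α_t} are pairwise distinct standard monomials, then each coefficient c_i is normal in R. -/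
/-- The elements of `A` that commute with the coefficients up to an automorphism of `R`. -/
def twistedCentralizer {R A : Type*} [Ring R] [Ring A] (ι : R →+* A) : Submonoid A where
  carrier := {a | ∃ τ : R ≃+* R, ∀ r, a * ι r = ι (τ r) * a}
  one_mem' := ⟨RingEquiv.refl R, fun r => by simp⟩
  mul_mem' := by
    rintro a b ⟨τ, hτ⟩ ⟨ρ, hρ⟩
    exact ⟨ρ.trans τ, fun r => by
      rw [mul_assoc, hρ, ← mul_assoc, hτ, mul_assoc, RingEquiv.trans_apply]⟩

theorem smon_mem {A : Type*} [Ring A] {n : ℕ} (S : Submonoid A) {x : Fin n → A}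
    (hx : ∀ i, x i ∈ S) (α : Fin n → ℕ) : smon x α ∈ S := by
  refine S.list_prod_mem fun a ha => ?_
  obtain ⟨i, rfl⟩ := List.mem_ofFn.1 ha
  exact S.pow_mem (hx i) _

theorem smon_succ {A : Type*} [Ring A] {n : ℕ} (x : Fin (n + 1) → A) (α : Fin (n + 1) → ℕ) :
    smon x α = x 0 ^ α 0 * smon (fun i => x i.succ) fun i => α i.succ := by
  simp [smon, List.ofFn_succ]

theorem smon_zero {A : Type*} [Ring A] {n : ℕ} (x : Fin n → A) : smon x 0 = 1 := by
  simp [smon]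

section

variable {R A : Type*} [Ring R] [Ring A] {n : ℕ} {ι : R →+* A}

theorem exists_mul_pow {a b : A} {u : R} (ha : a ∈ twistedCentralizer ι)
    (h : b * a = ι u * (a * b)) (k : ℕ) :
    ∃ v, b * a ^ k = ι v * (a ^ k * b) := by
  induction k with
  | zero => exact ⟨1, by simp⟩
  | succ k ih =>
    obtain ⟨v, hv⟩ := ih
    obtain ⟨τ, hτ⟩ := (twistedCentralizer ι).pow_mem ha k
    refine ⟨v * τ u, ?_⟩
    rw [pow_succ, ← mul_assoc, hv, mul_assoc, mul_assoc, h, ← mul_assoc (a ^ k), hτ]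
    simp only [map_mul, mul_assoc]

theorem exists_mul_smon {x : Fin n → A} (hx : ∀ i, x i ∈ twistedCentralizer ι)
    (hq : ∀ i j : Fin n, i < j → ∃ u, x j * x i = ι u * (x i * x j))
    (i : Fin n) (α : Fin n → ℕ) :
    ∃ r, x i * smon x α = ι r * smon x (α + Pi.single i 1) := by
  induction n with
  | zero => exact i.elim0
  | succ n ih =>
    refine Fin.cases ?_ (fun j => ?_) i
    · refine ⟨1, ?_⟩
      simp [smon_succ, pow_succ', mul_assoc, Fin.succ_ne_zero]
    · obtain ⟨r, hr⟩ := ih (fun i => hx i.succ)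
        (fun i j hij => hq i.succ j.succ (Fin.succ_lt_succ_iff.2 hij)) j fun i => α i.succ
      obtain ⟨u, hu⟩ := hq 0 j.succ (Fin.succ_pos j)
      obtain ⟨v, hv⟩ := exists_mul_pow (hx 0) hu (α 0)
      obtain ⟨τ, hτ⟩ := (twistedCentralizer ι).pow_mem (hx 0) (α 0)
      refine ⟨v * τ r, ?_⟩
      have e : (fun k : Fin n => (α + Pi.single j.succ 1 : Fin (n + 1) → ℕ) k.succ) =
          (fun k => α k.succ) + Pi.single j 1 := by
        ext k
        simp [Pi.single_apply]
      have e0 : (α + Pi.single j.succ 1 : Fin (n + 1) → ℕ) 0 = α 0 := by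
        simp [(Fin.succ_ne_zero j).symm]
      rw [smon_succ, smon_succ, e, e0, ← mul_assoc, hv, mul_assoc, mul_assoc, hr,
        ← mul_assoc _ (ι r), hτ]
      simp only [map_mul, mul_assoc]

theorem exists_pow_mul_smon {x : Fin n → A} (hx : ∀ i, x i ∈ twistedCentralizer ι)
    (hq : ∀ i j : Fin n, i < j → ∃ u, x j * x i = ι u * (x i * x j))
    (i : Fin n) (k : ℕ) (β : Fin n → ℕ) :
    ∃ r, x i ^ k * smon x β = ι r * smon x (β + Pi.single i k) := by
  induction k with
  | zero => exact ⟨1, by simp⟩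
  | succ k ih =>
    obtain ⟨r, hr⟩ := ih
    obtain ⟨s, hs⟩ := exists_mul_smon hx hq i (β + Pi.single i k)
    obtain ⟨τ, hτ⟩ := hx i
    refine ⟨τ r * s, ?_⟩
    rw [pow_succ', mul_assoc, hr, ← mul_assoc, hτ, mul_assoc, hs, add_assoc, ← Pi.single_add,
      map_mul, mul_assoc]

theorem exists_smon_mul_smon {x : Fin n → A} (hx : ∀ i, x i ∈ twistedCentralizer ι)
    (hq : ∀ i j : Fin n, i < j → ∃ u, x j * x i = ι u * (x i * x j)) (α β : Fin n → ℕ) :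
    ∃ r, smon x α * smon x β = ι r * smon x (α + β) := by
  have key : ∀ l : List (Fin n), ∃ r, (l.map fun i => x i ^ α i).prod * smon x β =
      ι r * smon x ((l.map fun i => Pi.single i (α i)).sum + β) := by
    intro l
    induction l with
    | nil => exact ⟨1, by simp⟩
    | cons i l ih =>
      obtain ⟨r, hr⟩ := ih
      obtain ⟨s, hs⟩ := exists_pow_mul_smon hx hq i (α i)
        ((l.map fun i => Pi.single i (α i)).sum + β)
      obtain ⟨τ, hτ⟩ := (twistedCentralizer ι).pow_mem (hx i) (α i)
      refine ⟨τ r * s, ?_⟩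
      rw [List.map_cons, List.prod_cons, mul_assoc, hr, ← mul_assoc, hτ, mul_assoc, hs,
        List.map_cons, List.sum_cons, map_mul, mul_assoc, add_right_comm,
        add_comm (List.sum _) (Pi.single i _)]
  obtain ⟨r, hr⟩ := key (List.finRange n)
  refine ⟨r, ?_⟩
  have hs : ((List.finRange n).map fun i => (Pi.single i (α i) : Fin n → ℕ)).sum = α := by
    rw [← List.ofFn_eq_map, List.sum_ofFn, Finset.univ_sum_single]
  rw [hs] at hr
  rw [← hr, smon, List.ofFn_eq_map]

/-- The elements of `A` whose coordinates are supported on exponents of total degree in `S`. -/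
def degreeSubgroup (e : ((Fin n → ℕ) →₀ R) ≃+ A) (S : Set ℕ) : AddSubgroup A where
  carrier := {a | ∀ α, e.symm a α ≠ 0 → ∑ i, α i ∈ S}
  zero_mem' := by simp
  add_mem' := by
    intro a b ha hb α h
    by_cases h' : e.symm a α = 0
    · exact hb α fun h0 => h (by simp [h', h0])
    · exact ha α h'
  neg_mem' := by
    intro a ha α h
    exact ha α fun h0 => h (by simp [h0])

theorem degreeSubgroup_mono (e : ((Fin n → ℕ) →₀ R) ≃+ A) {S T : Set ℕ} (h : S ⊆ T) :
    degreeSubgroup e S ≤ degreeSubgroup e T :=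
  fun _ ha α hα => h (ha α hα)

theorem eq_zero_of_mem_degreeSubgroup (e : ((Fin n → ℕ) →₀ R) ≃+ A) {S T : Set ℕ}
    (h : Disjoint S T) {a : A} (hS : a ∈ degreeSubgroup e S) (hT : a ∈ degreeSubgroup e T) :
    a = 0 := by
  refine e.symm.map_eq_zero_iff.1 (Finsupp.ext fun α => ?_)
  by_contra hα
  exact Set.disjoint_left.1 h (hS α hα) (hT α hα)

theorem apply_mem_degreeSubgroup (e : ((Fin n → ℕ) →₀ R) ≃+ A) {S : Set ℕ}
    {c : (Fin n → ℕ) →₀ R} (h : ∀ α, c α ≠ 0 → ∑ i, α i ∈ S) : e c ∈ degreeSubgroup e S := by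
  intro α hα
  rw [AddEquiv.symm_apply_apply] at hα
  exact h α hα

theorem exists_leading_form (e : ((Fin n → ℕ) →₀ R) ≃+ A) {a : A} (ha : a ≠ 0) :
    ∃ d, ∃ b ∈ degreeSubgroup e {d}, ∃ c ∈ degreeSubgroup e (Set.Iio d), b ≠ 0 ∧ a = b + c := by
  have hne : (e.symm a).support.Nonempty := by
    rw [Finsupp.support_nonempty_iff]
    exact fun h => ha (e.symm.map_eq_zero_iff.1 h)
  obtain ⟨β, hβ, hmax⟩ := Finset.exists_max_image _ (fun α : Fin n → ℕ => ∑ i, α i) hne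
  let p : (Fin n → ℕ) → Prop := fun α => ∑ i, α i = ∑ i, β i
  classical
  refine ⟨∑ i, β i, e ((e.symm a).filter p), ?_, e ((e.symm a).filter fun α => ¬ p α), ?_, ?_, ?_⟩
  · refine apply_mem_degreeSubgroup e fun α hα => ?_
    by_contra h
    exact hα (Finsupp.filter_apply_neg p _ h)
  · refine apply_mem_degreeSubgroup e fun α hα => ?_
    have h : ¬ p α := by
      by_contra h
      exact hα (Finsupp.filter_apply_neg _ _ (not_not.2 h))
    rw [Finsupp.filter_apply_pos (fun α => ¬ p α) _ h] at hα
    exact lt_of_le_of_ne (hmax α (Finsupp.mem_support_iff.2 hα)) h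
  · intro h
    have h' := DFunLike.congr_fun (e.map_eq_zero_iff.1 h) β
    rw [Finsupp.filter_apply_pos p _ rfl] at h'
    exact Finsupp.mem_support_iff.1 hβ h'
  · rw [← map_add, Finsupp.filter_add_filter_not, AddEquiv.apply_symm_apply]

variable {x : Fin n → A} (e : ((Fin n → ℕ) →₀ R) ≃+ A)

theorem apply_single (he : ∀ c, e c = c.sum fun α r => ι r * smon x α) (α : Fin n → ℕ) (r : R) :
    e (Finsupp.single α r) = ι r * smon x α := by
  rw [he, Finsupp.sum_single_index (by simp)]

theorem monomial_mem_degreeSubgroup (he : ∀ c, e c = c.sum fun α r => ι r * smon x α)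
    {S : Set ℕ} {α : Fin n → ℕ} (h : ∑ i, α i ∈ S) (r : R) :
    ι r * smon x α ∈ degreeSubgroup e S := by
  rw [← apply_single e he]
  refine apply_mem_degreeSubgroup e fun β hβ => ?_
  have : α = β := by
    by_contra h'
    exact hβ (Finsupp.single_eq_of_ne' h')
  exact this ▸ h

theorem coeff_mem_degreeSubgroup (he : ∀ c, e c = c.sum fun α r => ι r * smon x α) (r : R) :
    ι r ∈ degreeSubgroup e {0} := by
  simpa [smon_zero] using monomial_mem_degreeSubgroup e he (S := {0}) (α := 0) (by simp) r

theorem exists_coeff_of_mem_degreeSubgroup (he : ∀ c, e c = c.sum fun α r => ι r * smon x α)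
    {a : A} (ha : a ∈ degreeSubgroup e {0}) : ∃ r, a = ι r := by
  refine ⟨e.symm a 0, ?_⟩
  have h : e.symm a = Finsupp.single 0 (e.symm a 0) := by
    ext α
    by_cases hα : α = 0
    · simp [hα]
    · rw [Finsupp.single_eq_of_ne hα]
      by_contra h
      have := ha α h
      rw [Set.mem_singleton_iff, Finset.sum_eq_zero_iff] at this
      exact hα (funext fun i => this i (Finset.mem_univ i))
  have h' := congrArg e h
  rwa [e.apply_symm_apply, apply_single e he, smon_zero, mul_one] at h'

theorem mul_mem_degreeSubgroup (he : ∀ c, e c = c.sum fun α r => ι r * smon x α)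
    (hx : ∀ i, x i ∈ twistedCentralizer ι)
    (hq : ∀ i j : Fin n, i < j → ∃ u, x j * x i = ι u * (x i * x j))
    {S T U : Set ℕ} (h : ∀ s ∈ S, ∀ t ∈ T, s + t ∈ U) {a b : A}
    (ha : a ∈ degreeSubgroup e S) (hb : b ∈ degreeSubgroup e T) :
    a * b ∈ degreeSubgroup e U := by
  rw [← e.apply_symm_apply a, ← e.apply_symm_apply b, he, he, Finsupp.sum, Finsupp.sum,
    Finset.sum_mul_sum]
  refine sum_mem fun α hα => sum_mem fun β hβ => ?_
  obtain ⟨τ, hτ⟩ := smon_mem _ hx α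
  obtain ⟨r, hr⟩ := exists_smon_mul_smon hx hq α β
  rw [mul_assoc, ← mul_assoc (smon x α), hτ, mul_assoc, hr, ← mul_assoc, ← mul_assoc, ← map_mul,
    ← map_mul]
  refine monomial_mem_degreeSubgroup e he ?_ _
  simp only [Pi.add_apply, Finset.sum_add_distrib]
  exact h _ (ha α (Finsupp.mem_support_iff.1 hα)) _ (hb β (Finsupp.mem_support_iff.1 hβ))

/-- In a domain, the degree of a product is the sum of the degrees. -/
theorem add_mem_of_mul_mem_degreeSubgroup [IsDomain A]
    (he : ∀ c, e c = c.sum fun α r => ι r * smon x α) (hx : ∀ i, x i ∈ twistedCentralizer ι)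
    (hq : ∀ i j : Fin n, i < j → ∃ u, x j * x i = ι u * (x i * x j))
    {d k : ℕ} {a a' b b' : A} (ha : a ∈ degreeSubgroup e {d})
    (ha' : a' ∈ degreeSubgroup e (Set.Iio d)) (hb : b ∈ degreeSubgroup e {k})
    (hb' : b' ∈ degreeSubgroup e (Set.Iio k)) (ha0 : a ≠ 0) (hb0 : b ≠ 0) {S : Set ℕ}
    (h : (a + a') * (b + b') ∈ degreeSubgroup e S) : d + k ∈ S := by
  by_contra hS
  have hlow : a * b' + a' * (b + b') ∈ degreeSubgroup e {m | m ≠ d + k} := by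
    refine add_mem (mul_mem_degreeSubgroup e he hx hq ?_ ha hb')
      (mul_mem_degreeSubgroup e he hx hq (T := Set.Iic k) ?_ ha' (add_mem ?_ ?_))
    · intro s hs t ht
      simp only [Set.mem_singleton_iff, Set.mem_Iio, Set.mem_ofPred_eq] at *
      omega
    · intro s hs t ht
      simp only [Set.mem_Iic, Set.mem_Iio, Set.mem_ofPred_eq] at *
      omega
    · exact degreeSubgroup_mono e (by simp) hb
    · exact degreeSubgroup_mono e Set.Iio_subset_Iic_self hb'
  have hS' : S ⊆ {m | m ≠ d + k} := fun m hm hmd => hS (hmd ▸ hm)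
  have hab : a * b ∈ degreeSubgroup e {m | m ≠ d + k} := by
    have := sub_mem (degreeSubgroup_mono e hS' h) hlow
    rwa [show (a + a') * (b + b') - (a * b' + a' * (b + b')) = a * b by noncomm_ring] at this
  refine mul_ne_zero ha0 hb0 (eq_zero_of_mem_degreeSubgroup e ?_ hab
    (mul_mem_degreeSubgroup e he hx hq (U := {d + k}) ?_ ha hb))
  · simp
  · rintro s rfl t rfl
    rfl

/-- If multiplication by `a` on the left or on the right has the same effect on `f ≠ 0` as
multiplication by a coefficient on the other side, then `a` is a coefficient. -/
theorem exists_coeff_of_mul_eq [IsDomain A]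
    (he : ∀ c, e c = c.sum fun α r => ι r * smon x α) (hx : ∀ i, x i ∈ twistedCentralizer ι)
    (hq : ∀ i j : Fin n, i < j → ∃ u, x j * x i = ι u * (x i * x j))
    {f a : A} (hf : f ≠ 0) {r : R} (h : f * a = ι r * f ∨ a * f = f * ι r) : ∃ s, a = ι s := by
  by_cases ha : a = 0
  · exact ⟨0, by simp [ha]⟩
  obtain ⟨d, g, hg, g', hg', hg0, hfg⟩ := exists_leading_form e hf
  obtain ⟨k, b, hb, b', hb', hb0, hab⟩ := exists_leading_form e ha
  have hfd : f ∈ degreeSubgroup e (Set.Iic d) :=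
    hfg ▸ add_mem (degreeSubgroup_mono e (by simp) hg)
      (degreeSubgroup_mono e Set.Iio_subset_Iic_self hg')
  have hr := coeff_mem_degreeSubgroup e he r
  have hk : k = 0 := by
    rcases h with h | h
    · have hm : f * a ∈ degreeSubgroup e (Set.Iic d) := h ▸
        mul_mem_degreeSubgroup e he hx hq (by simp) hr hfd
      rw [hfg, hab] at hm
      simpa using add_mem_of_mul_mem_degreeSubgroup e he hx hq hg hg' hb hb' hg0 hb0 hm
    · have hm : a * f ∈ degreeSubgroup e (Set.Iic d) := h ▸
        mul_mem_degreeSubgroup e he hx hq (by simp) hfd hr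
      rw [hfg, hab] at hm
      simpa using add_mem_of_mul_mem_degreeSubgroup e he hx hq hb hb' hg hg' hb0 hg0 hm
  subst hk
  refine exists_coeff_of_mem_degreeSubgroup e he (hab ▸ add_mem hb ?_)
  exact degreeSubgroup_mono e (fun m hm => absurd hm (Nat.not_lt_zero m)) hb'

theorem coeff_eq_of_sum_eq (he : ∀ c, e c = c.sum fun α r => ι r * smon x α) {t : ℕ}
    {α : Fin t → Fin n → ℕ} (hα : Function.Injective α) {c d : Fin t → R}
    (h : ∑ i, ι (c i) * smon x (α i) = ∑ i, ι (d i) * smon x (α i)) (i : Fin t) : c i = d i := by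
  simp only [← apply_single e he, ← map_sum] at h
  simpa [Finsupp.finsetSum_apply, Finsupp.single_apply, hα.eq_iff] using
    DFunLike.congr_fun (e.injective h) (α i)

end

theorem stmt12 {R A : Type*} [Ring R] [Ring A] [IsDomain A] {n : ℕ}
    (ι : R →+* A) (hι : Function.Injective ι) (x : Fin n → A)
    -- (1) the standard monomials form a basis of A as a left R-module
    (hbasis : ∀ a : A, ∃! c : (Fin n → ℕ) →₀ R, a = c.sum fun α r => ι r * smon x α)
    -- (2) ring automorphisms σ_i of R with x_i r = σ_i(r) x_i
    (σ : Fin n → R ≃+* R) (hσ : ∀ (i : Fin n) (r : R), x i * ι r = ι (σ i r) * x i)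
    -- (3) invertible q_{ij} ∈ R with x_j x_i = q_{ij} x_i x_j for i < j
    (q : Fin n → Fin n → Rˣ)
    (hq : ∀ i j : Fin n, i < j → x j * x i = ι (q i j) * (x i * x j))
    -- f = c_1 x^{α_1} + ⋯ + c_t x^{α_t}, nonzero coefficients, distinct monomials
    (t : ℕ) (c : Fin t → R) (hc : ∀ i, c i ≠ 0)
    (α : Fin t → Fin n → ℕ) (hα : Function.Injective α)
    (f : A) (hf : f = ∑ i, ι (c i) * smon x (α i)) (hf0 : f ≠ 0)
    -- f is normal in A
    (hnormal : {a * f | a : A} = {f * a | a : A}) :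
    -- each coefficient c_i is normal in R
    ∀ i, {r * c i | r : R} = {c i * r | r : R} := by
  let L : ((Fin n → ℕ) →₀ R) →+ A :=
    Finsupp.liftAddHom fun α => (AddMonoidHom.mulRight (smon x α)).comp ι.toAddMonoidHom
  have hL : ∀ c, L c = c.sum fun α r => ι r * smon x α := fun c => rfl
  have hbij : Function.Bijective L := Function.bijective_iff_existsUnique L |>.2 fun a => by
    simpa only [hL, eq_comm] using hbasis a
  let e := AddEquiv.ofBijective L hbij
  have he : ∀ c, e c = c.sum fun α r => ι r * smon x α := hL
  have hx : ∀ i, x i ∈ twistedCentralizer ι := fun i => ⟨σ i, hσ i⟩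
  have hq' : ∀ i j : Fin n, i < j → ∃ u, x j * x i = ι u * (x i * x j) :=
    fun i j hij => ⟨q i j, hq i j hij⟩
  choose τ hτ using fun i => smon_mem _ hx (α i)
  have hcoeff : ∀ r s, ι r * f = f * ι s → ∀ i, r * c i = c i * τ i s := by
    intro r s h
    refine coeff_eq_of_sum_eq e he hα ?_
    rw [hf, Finset.mul_sum, Finset.sum_mul] at h
    simpa only [map_mul, mul_assoc, hτ] using h
  intro i
  ext y
  constructor
  · rintro ⟨r, rfl⟩
    obtain ⟨a, ha⟩ : ι r * f ∈ {f * a | a : A} := hnormal ▸ ⟨ι r, rfl⟩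
    obtain ⟨s, rfl⟩ := exists_coeff_of_mul_eq e he hx hq' hf0 (Or.inl ha)
    exact ⟨τ i s, (hcoeff r s ha.symm i).symm⟩
  · rintro ⟨r, rfl⟩
    obtain ⟨a, ha⟩ : f * ι ((τ i).symm r) ∈ {a * f | a : A} := hnormal ▸ ⟨_, rfl⟩
    obtain ⟨s, rfl⟩ := exists_coeff_of_mul_eq e he hx hq' hf0 (Or.inr ha)
    exact ⟨s, by simpa using hcoeff s _ ha i⟩
end

section
/- Let f ∈ B with leading coefficient lc(f) a unit of S. Then f is a normal element of B if and only if f = c x^t h for some unit c of S that is normal in S, some integer t ≥ 0, and some h in the center Z(B) of B. -/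
open Polynomial

/-- A polynomial that commutes with all constants is central. -/
theorem Polynomial.mem_center_of_commute_C {S : Type*} [Semiring S] {h : S[X]}
    (hC : ∀ r : S, C r * h = h * C r) : h ∈ Set.center S[X] := by
  rw [Semigroup.mem_center_iff]
  intro g
  induction g using Polynomial.induction_on' with
  | add p q hp hq => rw [add_mul, mul_add, hp, hq]
  | monomial n a =>
    rw [← C_mul_X_pow_eq_monomial, mul_assoc, X_pow_mul, ← mul_assoc, hC, mul_assoc]

/-- If `h` is monic and `C r * h = h * b`, then `b` is the constant `r`. -/
theorem Polynomial.Monic.eq_C_of_C_mul_eq_mul {S : Type*} [Semiring S] {h b : S[X]}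
    (hm : h.Monic) {r : S} (e : C r * h = h * b) : b = C r := by
  obtain ⟨s, rfl⟩ : ∃ s, b = C s := by
    refine ⟨b.coeff 0, eq_C_of_natDegree_eq_zero ?_⟩
    by_cases hb : b = 0
    · simp [hb]
    · have h₁ := hm.natDegree_mul' hb
      have h₂ := natDegree_C_mul_le r h
      rw [e] at h₂
      lia
  have h₁ := congrArg (fun p => p.coeff h.natDegree) e
  simp only [coeff_C_mul, coeff_mul_C, hm.coeff_natDegree, mul_one, one_mul] at h₁
  rw [h₁]

/-- Units are normal elements. -/
theorem Units.setOf_mul_right_eq_setOf_mul_left {S : Type*} [Monoid S] (c : Sˣ) :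
    {r * (c : S) | r : S} = {(c : S) * r | r : S} := by
  ext a
  exact ⟨fun _ => ⟨↑c⁻¹ * a, c.mul_inv_cancel_left a⟩,
    fun _ => ⟨a * ↑c⁻¹, c.inv_mul_cancel_right a⟩⟩

/-- The product of a unit and a central element is normal. -/
theorem Units.setOf_mul_right_eq_setOf_mul_left_of_mem_center {B : Type*} [Monoid B] (u : Bˣ)
    {z : B} (hz : z ∈ Set.center B) :
    {b * (u * z) | b : B} = {(u * z) * b | b : B} := by
  rw [Semigroup.mem_center_iff] at hz
  ext a
  constructor
  · rintro ⟨b, rfl⟩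
    exact ⟨↑u⁻¹ * b * u, by rw [mul_assoc, ← hz]; simp [mul_assoc]⟩
  · rintro ⟨b, rfl⟩
    exact ⟨u * b * ↑u⁻¹, by simp [mul_assoc, hz b]⟩

theorem stmt13 {S : Type*} [Ring S] [IsDomain S] [IsNoetherianRing S]
    (f : S[X]) (hf : IsUnit f.leadingCoeff) :
    -- f is normal in B = S[x]  ↔  f = c x^t h with c a normal unit of S and h central
    ({b * f | b : S[X]} = {f * b | b : S[X]}) ↔
      ∃ (c : Sˣ) (t : ℕ) (h : S[X]),
        ({r * (c : S) | r : S} = {(c : S) * r | r : S}) ∧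
        h ∈ Set.center S[X] ∧
        f = Polynomial.C (c : S) * Polynomial.X ^ t * h := by
  constructor
  · intro hn
    obtain ⟨c, hc⟩ := hf
    have hm : (C (↑c⁻¹ : S) * f).Monic := by
      rw [Monic, leadingCoeff_mul, leadingCoeff_C, ← hc, Units.inv_mul]
    have hfc : f = C (c : S) * (C (↑c⁻¹ : S) * f) := by
      rw [← mul_assoc, ← C_mul, Units.mul_inv, C_1, one_mul]
    refine ⟨c, 0, C (↑c⁻¹ : S) * f, c.setOf_mul_right_eq_setOf_mul_left,
      mem_center_of_commute_C fun r => ?_, by rw [pow_zero, mul_one, ← hfc]⟩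
    have hmem : C (c * r * ↑c⁻¹ : S) * f ∈ {f * b | b : S[X]} := hn ▸ ⟨_, rfl⟩
    obtain ⟨b, hb⟩ := hmem
    have e : C r * (C (↑c⁻¹ : S) * f) = C (↑c⁻¹ : S) * f * b := by
      rw [mul_assoc _ f b, hb, ← mul_assoc, ← mul_assoc, ← C_mul, ← C_mul]
      simp [mul_assoc]
    rwa [hm.eq_C_of_C_mul_eq_mul e] at e
  · rintro ⟨c, t, h, -, hh, rfl⟩
    have hX : (X ^ t : S[X]) ∈ Set.center S[X] :=
      mem_center_of_commute_C fun r => (X_pow_mul_C r t).symm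
    rw [mul_assoc]
    exact (Units.map (C : S →+* S[X]).toMonoidHom c).setOf_mul_right_eq_setOf_mul_left_of_mem_center
      (Set.mul_mem_center hX hh)
end

section
/- Let F be an algebraically closed field and suppose S is an F-algebra whose center equals the image of F in S. Let f_1, …, f_r ∈ B be nonzero normal elements with lc(f_i) a unit of S for every i, and let I := Bf_1 + ⋯ + Bf_r be the left ideal they generate. If there is no z ∈ S such that I is contained in the two-sided ideal of B generated by x − z (i.e., V(I) = ∅), then I = B. -/
open Polynomial

/-- A normal polynomial over a domain with unit leading coefficient `u` becomes, after division
by `u`, a polynomial with central coefficients. -/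
theorem coeff_mul_inv_leadingCoeff_mem_center {S : Type*} [Ring S] [IsDomain S] {f : S[X]}
    (hf : {b * f | b : S[X]} ⊆ {f * b | b : S[X]}) {u : Sˣ}
    (hu : (u : S) = f.leadingCoeff) (n : ℕ) :
    f.coeff n * (↑u⁻¹ : S) ∈ Set.center S := by
  have hf0 : f ≠ 0 := by
    rintro rfl
    simp at hu
  rw [Semigroup.mem_center_iff]
  intro s
  obtain rfl | hs := eq_or_ne s 0
  · simp
  obtain ⟨b, hb⟩ := hf ⟨C s, rfl⟩
  have hb0 : b ≠ 0 := by
    rintro rfl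
    rw [mul_zero] at hb
    exact mul_ne_zero (C_ne_zero.mpr hs) hf0 hb.symm
  have hdeg : b.natDegree = 0 := by
    have h := congrArg natDegree hb
    rw [natDegree_mul hf0 hb0, natDegree_mul (C_ne_zero.mpr hs) hf0, natDegree_C] at h
    lia
  obtain ⟨t, rfl⟩ := natDegree_eq_zero.mp hdeg
  have hcoeff (k : ℕ) : f.coeff k * t = s * f.coeff k := by
    simpa using congrArg (fun p => p.coeff k) hb
  have hlead : (u : S) * t = s * u := by
    rw [hu]
    exact hcoeff _
  have ht : t = ↑u⁻¹ * s * u := by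
    rw [mul_assoc, ← hlead, Units.inv_mul_cancel_left]
  calc s * (f.coeff n * ↑u⁻¹) = f.coeff n * t * ↑u⁻¹ := by rw [hcoeff, mul_assoc]
    _ = f.coeff n * ↑u⁻¹ * s := by rw [ht]; simp [mul_assoc]

/-- If the center is the image of `F`, a normal polynomial with unit leading coefficient is a unit
constant times a polynomial over `F`. -/
theorem exists_eq_C_mul_map {F S : Type*} [Field F] [Ring S] [IsDomain S] [Algebra F S]
    (hcenter : Set.center S = Set.range (algebraMap F S)) {f : S[X]}
    (hf : {b * f | b : S[X]} ⊆ {f * b | b : S[X]}) (hlc : IsUnit f.leadingCoeff) :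
    ∃ (p : F[X]) (u : Sˣ), f = C (u : S) * p.map (algebraMap F S) := by
  obtain ⟨u, hu⟩ := hlc
  have hc := coeff_mul_inv_leadingCoeff_mem_center hf hu
  have hlift : f * C (↑u⁻¹ : S) ∈ lifts (algebraMap F S) := by
    rw [lifts_iff_coeff_lifts]
    intro n
    rw [coeff_mul_C, ← hcenter]
    exact hc n
  obtain ⟨p, hp⟩ := (mem_lifts _).mp hlift
  refine ⟨p, u, ?_⟩
  ext n
  have h := Semigroup.mem_center_iff.mp (hc n) u
  rw [hp, coeff_C_mul, coeff_mul_C, h, Units.inv_mul_cancel_right]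

/-- Over an algebraically closed field every proper ideal of polynomials has a common root. -/
theorem exists_X_sub_C_dvd_of_ne_top {F : Type*} [Field F] [IsAlgClosed F] {J : Ideal F[X]}
    (hJ : J ≠ ⊤) : ∃ a : F, ∀ p ∈ J, X - C a ∣ p := by
  obtain ⟨d, rfl⟩ := (IsPrincipalIdealRing.principal J).principal
  change Ideal.span {d} ≠ ⊤ at hJ
  rw [Ne, Ideal.span_singleton_eq_top] at hJ
  obtain ⟨a, ha⟩ : ∃ a, IsRoot d a := by
    obtain rfl | hd := eq_or_ne d 0
    · exact ⟨0, by simp⟩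
    · exact IsAlgClosed.exists_root d fun h => hJ (isUnit_iff_degree_eq_zero.mpr h)
  exact ⟨a, fun p hp => (dvd_iff_isRoot.mpr ha).trans (Ideal.mem_span_singleton.mp hp)⟩

theorem stmt14 {F S : Type*} [Field F] [IsAlgClosed F]
    [Ring S] [IsDomain S] [IsNoetherianRing S] [Algebra F S]
    -- the center of S is (the image of) F
    (hcenter : Set.center S = Set.range (algebraMap F S))
    (r : ℕ) (f : Fin r → S[X])
    (hf0 : ∀ i, f i ≠ 0)
    -- each f_i is normal in B = S[x]
    (hfn : ∀ i, {b * f i | b : S[X]} = {f i * b | b : S[X]})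
    -- each f_i has unit leading coefficient
    (hlc : ∀ i, IsUnit (f i).leadingCoeff)
    -- I = Bf_1 + ⋯ + Bf_r
    (I : Ideal S[X]) (hI : I = Ideal.span (Set.range f))
    -- V(I) = ∅ : no z ∈ S with I contained in the two-sided ideal generated by x - z
    (hV : ¬ ∃ z : S, ∀ g ∈ I, g ∈ TwoSidedIdeal.span {Polynomial.X - Polynomial.C z}) :
    I = ⊤ := by
  choose p u hp using fun i => exists_eq_C_mul_map hcenter (hfn i).subset (hlc i)
  by_cases hJ : Ideal.span (Set.range p) = ⊤
  · have hle : (Ideal.span (Set.range p)).map (mapRingHom (algebraMap F S)) ≤ I := by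
      rw [Ideal.map_span, Ideal.span_le]
      rintro _ ⟨_, ⟨i, rfl⟩, rfl⟩
      have hmem : C (↑(u i)⁻¹ : S) * f i ∈ I :=
        I.mul_mem_left _ (hI ▸ Ideal.subset_span ⟨i, rfl⟩)
      rw [hp i, ← mul_assoc, ← C_mul, Units.inv_mul, C_1, one_mul] at hmem
      exact hmem
    rw [hJ, Ideal.map_top] at hle
    exact top_le_iff.mp hle
  · obtain ⟨a, ha⟩ := exists_X_sub_C_dvd_of_ne_top hJ
    refine absurd ⟨algebraMap F S a, fun g hg => ?_⟩ hV
    rw [hI] at hg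
    induction hg using Submodule.span_induction with
    | mem g hg =>
      obtain ⟨i, rfl⟩ := hg
      obtain ⟨q, hq⟩ := ha _ (Ideal.subset_span ⟨i, rfl⟩)
      rw [hp i, hq, Polynomial.map_mul, Polynomial.map_sub, map_X, map_C]
      exact TwoSidedIdeal.mul_mem_left _ _ _
        (TwoSidedIdeal.mul_mem_right _ _ _ (TwoSidedIdeal.subset_span rfl))
    | zero => exact TwoSidedIdeal.zero_mem _
    | add g h _ _ hg hh => exact TwoSidedIdeal.add_mem _ hg hh
    | smul b g _ hg => exact TwoSidedIdeal.mul_mem_left _ _ _ hg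
end

section
/- Let F be an algebraically closed field, A a ring, and φ : F[y_1, …, y_n] → A an injective ring homomorphism from the commutative polynomial ring in n variables over F whose image equals the center Z(A) of A. Let I be a two-sided ideal of A and J := φ^{-1}(I). Then the two-sided ideal of A generated by φ(𝓘(𝓥(J))) is contained in √I, where 𝓥(J) := {p ∈ F^n : g(p) = 0 for all g ∈ J} and 𝓘(X) := {g ∈ F[y_1, …, y_n] : g(p) = 0 for all p ∈ X} are the classical vanishing set and vanishing ideal. -/
/-- A two-sided ideal `P ⊊ A` is prime if `aAb ⊆ P` implies `a ∈ P` or `b ∈ P`. -/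
def IsPrimeTwoSided {A : Type*} [Ring A] (P : TwoSidedIdeal A) : Prop :=
  P ≠ ⊤ ∧ ∀ a b : A, (∀ s : A, a * s * b ∈ P) → a ∈ P ∨ b ∈ P

/-- The classical vanishing set `𝓥(J) ⊆ F^n` of a set of commutative polynomials. -/
def clV {F : Type*} [CommSemiring F] {n : ℕ} (J : Set (MvPolynomial (Fin n) F)) :
    Set (Fin n → F) :=
  {p | ∀ g ∈ J, MvPolynomial.eval p g = 0}

/-- The classical vanishing ideal `𝓘(X)` of a set of points `X ⊆ F^n`. -/
def clI {F : Type*} [CommSemiring F] {n : ℕ} (X : Set (Fin n → F)) :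
    Set (MvPolynomial (Fin n) F) :=
  {g | ∀ p ∈ X, MvPolynomial.eval p g = 0}

/-- The classical Nullstellensatz, for the preimage of a two-sided ideal. -/
theorem exists_pow_mem_of_mem_clI_clV {F A : Type*} [Field F] [IsAlgClosed F] [Ring A] {n : ℕ}
    (φ : MvPolynomial (Fin n) F →+* A) (I : TwoSidedIdeal A) {g : MvPolynomial (Fin n) F}
    (hg : g ∈ clI (clV {g | φ g ∈ I})) : ∃ k : ℕ, φ g ^ k ∈ I := by
  let J : Ideal (MvPolynomial (Fin n) F) :=
    { carrier := {g | φ g ∈ I}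
      add_mem' := fun {a b} ha hb => by
        simpa only [Set.mem_ofPred_eq, map_add] using I.add_mem ha hb
      zero_mem' := by simpa only [Set.mem_ofPred_eq, map_zero] using I.zero_mem
      smul_mem' := fun c x hx => by
        simpa only [Set.mem_ofPred_eq, smul_eq_mul, map_mul] using I.mul_mem_left _ _ hx }
  have hrad : g ∈ J.radical := by
    rw [← MvPolynomial.vanishingIdeal_zeroLocus_eq_radical (K := F),
      MvPolynomial.mem_vanishingIdeal_iff]
    intro p hp
    rw [MvPolynomial.aeval_eq_eval]
    refine hg p fun f hf => ?_
    have := (MvPolynomial.mem_zeroLocus_iff).1 hp f hf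
    rwa [MvPolynomial.aeval_eq_eval] at this
  obtain ⟨k, hk⟩ := hrad
  have hk' : φ (g ^ k) ∈ I := hk
  exact ⟨k, by rwa [map_pow] at hk'⟩

/-- A central element with a power in a prime two-sided ideal lies in that ideal. -/
theorem IsPrimeTwoSided.mem_of_pow_mem {A : Type*} [Ring A] {P : TwoSidedIdeal A}
    (hP : IsPrimeTwoSided P) {z : A} (hz : z ∈ Set.center A) {k : ℕ} (hk : z ^ k ∈ P) :
    z ∈ P := by
  induction k with
  | zero => simpa using P.mul_mem_left z _ hk
  | succ k ih =>
    refine (hP.2 z (z ^ k) fun s => ?_).elim id ih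
    have h : z * s * z ^ k = s * z ^ (k + 1) := by
      rw [(Set.mem_center_iff.1 hz).comm s, mul_assoc, pow_succ']
    rw [h]
    exact P.mul_mem_left _ _ hk

theorem stmt17 {F A : Type*} [Field F] [IsAlgClosed F] [Ring A] {n : ℕ}
    (φ : MvPolynomial (Fin n) F →+* A) (hφ : Function.Injective φ)
    -- the image of φ is the center of A
    (hrange : Set.range φ = Set.center A)
    (I : TwoSidedIdeal A) :
    -- ⟨φ(𝓘(𝓥(J)))⟩ ⊆ √I, where J = φ⁻¹(I)
    TwoSidedIdeal.span (φ '' clI (clV {g | φ g ∈ I})) ≤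
      sInf {P : TwoSidedIdeal A | IsPrimeTwoSided P ∧ I ≤ P} := by
  refine le_sInf fun P ⟨hP, hIP⟩ => TwoSidedIdeal.span_le.2 ?_
  rintro _ ⟨g, hg, rfl⟩
  obtain ⟨k, hk⟩ := exists_pow_mem_of_mem_clI_clV φ I hg
  exact hP.mem_of_pow_mem (hrange ▸ Set.mem_range_self g) (hIP hk)
end
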